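/- arXiv:2306.02609 — 4 statements merged into one kernel-verified Lean document; each statement's English description precedes it below -/
import Mathlib

section
/- Let (X, 𝒜, σ) be a measure space with σ a finite measure, and let A, B, C be measurable sets. Then σ(A Δ B) = σ(A Δ C) + σ(C Δ B) if and only if σ((A ∩ B) \ C) = 0 and σ(C \ (A ∪ B)) = 0, i.e. if and only if C is between A and B up to σ-null sets. -/
open MeasureTheory

/-- The defect in the triangle inequality for the measure of symmetric differences. -/
theorem measure_symmDiff_add_measure_symmDiff {X : Type*} [MeasurableSpace X] (σ : Measure X)
    {A B C : Set X} (hA : MeasurableSet A) (hB : MeasurableSet B) (hC : MeasurableSet C) :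
    σ (symmDiff A C) + σ (symmDiff C B) =
      σ (symmDiff A B) + 2 * σ ((A ∩ B) \ C ∪ C \ (A ∪ B)) := by
  have hN : MeasurableSet ((A ∩ B) \ C ∪ C \ (A ∪ B)) :=
    ((hA.inter hB).diff hC).union (hC.diff (hA.union hB))
  have h_union : symmDiff A C ∪ symmDiff C B =
      symmDiff A B ∪ ((A ∩ B) \ C ∪ C \ (A ∪ B)) := by
    ext x
    simp only [Set.mem_union, Set.mem_symmDiff, Set.mem_sdiff, Set.mem_inter_iff]
    tauto
  have h_inter : symmDiff A C ∩ symmDiff C B = (A ∩ B) \ C ∪ C \ (A ∪ B) := by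
    ext x
    simp only [Set.mem_union, Set.mem_symmDiff, Set.mem_sdiff, Set.mem_inter_iff]
    tauto
  have h_disj : Disjoint (symmDiff A B) ((A ∩ B) \ C ∪ C \ (A ∪ B)) := by
    rw [Set.disjoint_left]
    intro x
    simp only [Set.mem_union, Set.mem_symmDiff, Set.mem_sdiff, Set.mem_inter_iff]
    tauto
  rw [← measure_union_add_inter _ (hC.symmDiff hB), h_union, h_inter,
    measure_union h_disj hN, add_assoc, two_mul]

theorem stmt_5 {X : Type*} [MeasurableSpace X] (σ : Measure X) [IsFiniteMeasure σ]
    (A B C : Set X) (hA : MeasurableSet A) (hB : MeasurableSet B) (hC : MeasurableSet C) :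
    σ (symmDiff A B) = σ (symmDiff A C) + σ (symmDiff C B) ↔
      σ ((A ∩ B) \ C) = 0 ∧ σ (C \ (A ∪ B)) = 0 := by
  rw [measure_symmDiff_add_measure_symmDiff σ hA hB hC, ← measure_union_null_iff, eq_comm]
  constructor
  · intro h
    have h_zero : 2 * σ ((A ∩ B) \ C ∪ C \ (A ∪ B)) = 0 :=
      (ENNReal.add_right_inj (measure_ne_top σ (symmDiff A B))).mp (h.trans (add_zero _).symm)
    simpa only [mul_eq_zero, OfNat.ofNat_ne_zero, false_or] using h_zero
  · intro h
    rw [h, mul_zero, add_zero]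
end

section
/- Let z = [[a, b], [b, a]] and w = [[c, d], [d, c]] be hyperbolic numbers, with z∧w and z∨w defined via m₊ = min(a+b, c+d), m₋ = min(a−b, c−d), M₊ = max(a+b, c+d), M₋ = max(a−b, c−d) as z∧w = ½[[m₊ + m₋, m₊ − m₋], [m₊ − m₋, m₊ + m₋]] and z∨w = ½[[M₊ + M₋, M₊ − M₋], [M₊ − M₋, M₊ + M₋]]. If m and M are hyperbolic numbers (matrices of the form [[p, q], [q, p]]) satisfying m ≤ z, m ≤ w, z ≤ M, and w ≤ M in the Loewner order, then m ≤ z∧w and z∨w ≤ M. In other words, z∧w is the largest hyperbolic lower bound and z∨w is the smallest hyperbolic upper bound of z and w. -/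
/-- The hyperbolic number `[[a, b], [b, a]]`. -/
def hyp (a b : ℝ) : Matrix (Fin 2) (Fin 2) ℝ := !![a, b; b, a]

/-- The meet `z ∧ w` of the hyperbolic numbers `z = [[a,b],[b,a]]` and `w = [[c,d],[d,c]]`:
`½ [[m₊ + m₋, m₊ − m₋], [m₊ − m₋, m₊ + m₋]]` with `m₊ = min (a+b) (c+d)`, `m₋ = min (a−b) (c−d)`. -/
noncomputable def hypMeet (a b c d : ℝ) : Matrix (Fin 2) (Fin 2) ℝ :=
  (1/2 : ℝ) • !![min (a+b) (c+d) + min (a-b) (c-d), min (a+b) (c+d) - min (a-b) (c-d);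
                 min (a+b) (c+d) - min (a-b) (c-d), min (a+b) (c+d) + min (a-b) (c-d)]

/-- The join `z ∨ w` of the hyperbolic numbers `z = [[a,b],[b,a]]` and `w = [[c,d],[d,c]]`. -/
noncomputable def hypJoin (a b c d : ℝ) : Matrix (Fin 2) (Fin 2) ℝ :=
  (1/2 : ℝ) • !![max (a+b) (c+d) + max (a-b) (c-d), max (a+b) (c+d) - max (a-b) (c-d);
                 max (a+b) (c+d) - max (a-b) (c-d), max (a+b) (c+d) + max (a-b) (c-d)]

theorem posSemidef_hyp_iff {x y : ℝ} : (hyp x y).PosSemidef ↔ 0 ≤ x + y ∧ 0 ≤ x - y := by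
  rw [Matrix.posSemidef_iff_dotProduct_mulVec]
  constructor
  · rintro ⟨-, h⟩
    have h₁ := h ![1, 1]
    have h₂ := h ![1, -1]
    simp [hyp, Matrix.mulVec, dotProduct, Fin.sum_univ_two] at h₁ h₂
    constructor <;> linarith
  · rintro ⟨h₁, h₂⟩
    refine ⟨?_, fun v ↦ ?_⟩
    · ext i j
      fin_cases i <;> fin_cases j <;> simp [hyp]
    · simp only [hyp, Matrix.mulVec, dotProduct, Fin.sum_univ_two, Matrix.of_apply,
        Matrix.cons_val_zero, Matrix.cons_val_one, Pi.star_apply, star_trivial]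
      nlinarith [mul_nonneg h₁ (sq_nonneg (v 0 + v 1)), mul_nonneg h₂ (sq_nonneg (v 0 - v 1))]

theorem hyp_sub_hyp (a b c d : ℝ) : hyp a b - hyp c d = hyp (a - c) (b - d) := by
  ext i j
  fin_cases i <;> fin_cases j <;> simp [hyp]

/-- The Loewner order on hyperbolic numbers is the product order on eigenvalues. -/
theorem posSemidef_hyp_sub_hyp_iff {a b c d : ℝ} :
    (hyp a b - hyp c d).PosSemidef ↔ c + d ≤ a + b ∧ c - d ≤ a - b := by
  rw [hyp_sub_hyp, posSemidef_hyp_iff]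
  constructor <;> rintro ⟨h₁, h₂⟩ <;> constructor <;> linarith

theorem hypMeet_eq_hyp (a b c d : ℝ) :
    hypMeet a b c d = hyp ((min (a + b) (c + d) + min (a - b) (c - d)) / 2)
      ((min (a + b) (c + d) - min (a - b) (c - d)) / 2) := by
  ext i j
  fin_cases i <;> fin_cases j <;> simp [hyp, hypMeet] <;> ring

theorem hypJoin_eq_hyp (a b c d : ℝ) :
    hypJoin a b c d = hyp ((max (a + b) (c + d) + max (a - b) (c - d)) / 2)
      ((max (a + b) (c + d) - max (a - b) (c - d)) / 2) := by
  ext i j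
  fin_cases i <;> fin_cases j <;> simp [hyp, hypJoin] <;> ring

theorem stmt_12 (a b c d p q r s : ℝ)
    (h1 : (hyp a b - hyp p q).PosSemidef) (h2 : (hyp c d - hyp p q).PosSemidef)
    (h3 : (hyp r s - hyp a b).PosSemidef) (h4 : (hyp r s - hyp c d).PosSemidef) :
    (hypMeet a b c d - hyp p q).PosSemidef ∧ (hyp r s - hypJoin a b c d).PosSemidef := by
  rw [posSemidef_hyp_sub_hyp_iff] at h1 h2 h3 h4
  rw [hypMeet_eq_hyp, hypJoin_eq_hyp, posSemidef_hyp_sub_hyp_iff, posSemidef_hyp_sub_hyp_iff]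
  have hm₁ := le_min h1.1 h2.1
  have hm₂ := le_min h1.2 h2.2
  have hM₁ := max_le h3.1 h4.1
  have hM₂ := max_le h3.2 h4.2
  refine ⟨⟨?_, ?_⟩, ?_, ?_⟩ <;> linarith
end

section
/- Let U = (1/√2)[[1,1],[1,−1]] and consider the hyperbolic numbers z = U·diag(1,2)·U, w = U·diag(3,0)·U, u = U·diag(2,0)·U, v = U·diag(5,1/2)·U. Then u is between z and w (i.e. z∧w ≤ u ≤ z∨w in the Loewner order) and w is between u and v (i.e. u∧v ≤ w ≤ u∨v), but u is NOT between z and v (it is not the case that z∧v ≤ u ≤ z∨v). Hence betweenness of hyperbolic numbers is not transitive. -/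
/-- The matrix `U = (1/√2) [[1,1],[1,−1]]`. -/
noncomputable def U : Matrix (Fin 2) (Fin 2) ℝ := (Real.sqrt 2)⁻¹ • !![1, 1; 1, -1]

/-- The hyperbolic number with idempotent representation `U·diag(λ₁,λ₂)·U`. -/
noncomputable def hd (l1 l2 : ℝ) : Matrix (Fin 2) (Fin 2) ℝ :=
  U * Matrix.diagonal ![l1, l2] * U

/-- `u` is between `z = hd λ₁ λ₂` and `w = hd μ₁ μ₂`:
`z ∧ w ≤ u ≤ z ∨ w` in the Loewner order, where
`z ∧ w = hd (min λ₁ μ₁) (min λ₂ μ₂)` and `z ∨ w = hd (max λ₁ μ₁) (max λ₂ μ₂)`. -/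
noncomputable def hypBetween (l1 l2 m1 m2 : ℝ) (u : Matrix (Fin 2) (Fin 2) ℝ) : Prop :=
  (u - hd (min l1 m1) (min l2 m2)).PosSemidef ∧ (hd (max l1 m1) (max l2 m2) - u).PosSemidef

theorem U_conjTranspose : U.conjTranspose = U := by
  ext i j
  fin_cases i <;> fin_cases j <;> simp [U]

theorem U_mul_self : U * U = 1 := by
  have h : (Real.sqrt 2)⁻¹ * (Real.sqrt 2)⁻¹ = 1 / 2 := by
    rw [← mul_inv, Real.mul_self_sqrt (by norm_num)]
    norm_num
  ext i j
  fin_cases i <;> fin_cases j <;> simp [U, Matrix.mul_apply, Fin.sum_univ_two] <;> linarith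

theorem hd_sub (a b c d : ℝ) : hd a b - hd c d = hd (a - c) (b - d) := by
  have h : Matrix.diagonal ![a - c, b - d] =
      Matrix.diagonal ![a, b] - Matrix.diagonal ![c, d] := by
    ext i j
    fin_cases i <;> fin_cases j <;> simp
  simp only [hd, h, mul_sub, sub_mul]

theorem hd_posSemidef_iff (a b : ℝ) : (hd a b).PosSemidef ↔ 0 ≤ a ∧ 0 ≤ b := by
  have hdiag : (Matrix.diagonal ![a, b]).PosSemidef ↔ 0 ≤ a ∧ 0 ≤ b := by
    simp [Matrix.posSemidef_diagonal_iff, Fin.forall_fin_two]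
  rw [← hdiag]
  constructor
  · intro h
    have h' := h.conjTranspose_mul_mul_same U
    have e : U * hd a b * U = Matrix.diagonal ![a, b] := by
      calc U * hd a b * U = (U * U) * Matrix.diagonal ![a, b] * (U * U) := by
            simp only [hd, mul_assoc]
        _ = Matrix.diagonal ![a, b] := by rw [U_mul_self, one_mul, mul_one]
    rwa [U_conjTranspose, e] at h'
  · intro h
    have h' := h.conjTranspose_mul_mul_same U
    rwa [U_conjTranspose] at h'

theorem stmt_14 :
    hypBetween 1 2 3 0 (hd 2 0) ∧
    hypBetween 2 0 5 (1/2) (hd 3 0) ∧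
    ¬ hypBetween 1 2 5 (1/2) (hd 2 0) := by
  simp only [hypBetween, hd_sub, hd_posSemidef_iff]
  norm_num
end

section
/- Let X be a set and let f₁, f₂, g₁, g₂, h₁, h₂ : X → [0,1] be membership functions. Then M_{h₁,h₂} is pointwise between M_{f₁,f₂} and M_{g₁,g₂} — meaning that for every x ∈ X, M_{f₁,f₂}(x) ∧ M_{g₁,g₂}(x) ≤ M_{h₁,h₂}(x) ≤ M_{f₁,f₂}(x) ∨ M_{g₁,g₂}(x) in the Loewner order — if and only if for every x ∈ X, min(f₁(x), g₁(x)) ≤ h₁(x) ≤ max(f₁(x), g₁(x)) and min(f₂(x), g₂(x)) ≤ h₂(x) ≤ max(f₂(x), g₂(x)). -/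
/-- The hyperbolic-valued membership function associated with membership
functions `f` and `g`. -/
noncomputable def Mfun {X : Type*} (f g : X → ℝ) (x : X) : Matrix (Fin 2) (Fin 2) ℝ :=
  (1/2 : ℝ) • !![f x + g x, f x - g x; f x - g x, f x + g x]

theorem posSemidef_Mfun_sub_iff {X : Type*} (f g f' g' : X → ℝ) (x : X) :
    (Mfun f g x - Mfun f' g' x).PosSemidef ↔ f' x ≤ f x ∧ g' x ≤ g x := by
  rw [Matrix.posSemidef_iff_dotProduct_mulVec]
  constructor
  · rintro ⟨-, h⟩
    have hplus := h ![1, 1]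
    have hminus := h ![1, -1]
    simp [Mfun, dotProduct, Matrix.mulVec, Fin.sum_univ_two] at hplus hminus
    constructor <;> linarith
  · rintro ⟨hf, hg⟩
    refine ⟨?_, fun v => ?_⟩
    · ext i j
      fin_cases i <;> fin_cases j <;> simp [Mfun]
    · have hquad : star v ⬝ᵥ (Mfun f g x - Mfun f' g' x).mulVec v =
          (1/2) * ((f x - f' x) * (v 0 + v 1) ^ 2 + (g x - g' x) * (v 0 - v 1) ^ 2) := by
        simp [Mfun, dotProduct, Matrix.mulVec, Fin.sum_univ_two]
        ring
      rw [hquad]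
      have hf' := sub_nonneg.2 hf
      have hg' := sub_nonneg.2 hg
      positivity

theorem stmt_19 {X : Type*} (f₁ f₂ g₁ g₂ h₁ h₂ : X → ℝ)
    (hf₁ : ∀ x, f₁ x ∈ Set.Icc (0:ℝ) 1) (hf₂ : ∀ x, f₂ x ∈ Set.Icc (0:ℝ) 1)
    (hg₁ : ∀ x, g₁ x ∈ Set.Icc (0:ℝ) 1) (hg₂ : ∀ x, g₂ x ∈ Set.Icc (0:ℝ) 1)
    (hh₁ : ∀ x, h₁ x ∈ Set.Icc (0:ℝ) 1) (hh₂ : ∀ x, h₂ x ∈ Set.Icc (0:ℝ) 1) :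
    (∀ x, (Mfun h₁ h₂ x -
            Mfun (fun y => min (f₁ y) (g₁ y)) (fun y => min (f₂ y) (g₂ y)) x).PosSemidef ∧
          (Mfun (fun y => max (f₁ y) (g₁ y)) (fun y => max (f₂ y) (g₂ y)) x -
            Mfun h₁ h₂ x).PosSemidef) ↔
      (∀ x, (min (f₁ x) (g₁ x) ≤ h₁ x ∧ h₁ x ≤ max (f₁ x) (g₁ x)) ∧
            (min (f₂ x) (g₂ x) ≤ h₂ x ∧ h₂ x ≤ max (f₂ x) (g₂ x))) := by
  simp only [posSemidef_Mfun_sub_iff]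
  exact forall_congr' fun x => and_and_and_comm
end
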